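/- arXiv:2406.16980 — 2 statements merged into one kernel-verified Lean document; each statement's English description precedes it below -/
import Mathlib

section
/- Let 0 < α < 1 and b₀ ∈ ℝ, and define y(t) = b₀ Σ_{n=0}^∞ t^{nα}/Γ(nα+1) for t ≥ 0 (that is, y(t) = b₀ E_α(t^α)). Then y(0) = b₀, and for every t > 0 the function u(t) = (1/Γ(α)) ∫_0^t y(τ) (t-τ)^{α-1} dτ is differentiable at t, y is differentiable at t, and u'(t) = y'(t). (That is, y solves the Riemann–Liouville fractional differential equation ₀D_t^{1-α} y(t) = y'(t) with y(0) = b₀.) -/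
open MeasureTheory Set Filter Topology

/-- Shrinking the Euler integral to `(R, ∞)` bounds the Gamma function from below. -/
lemma rpow_mul_exp_neg_le_Gamma_add_one {R x : ℝ} (hR : 0 < R) (hx : 0 ≤ x) :
    R ^ x * Real.exp (-R) ≤ Real.Gamma (x + 1) := by
  have hint := Real.GammaIntegral_convergent (s := x + 1) (by linarith)
  rw [Real.Gamma_eq_integral (by linarith)]
  simp only [add_sub_cancel_right] at hint ⊢
  calc R ^ x * Real.exp (-R) = ∫ t in Ioi R, R ^ x * Real.exp (-t) := by
        rw [integral_const_mul, integral_exp_neg_Ioi]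
    _ ≤ ∫ t in Ioi R, Real.exp (-t) * t ^ x := by
        refine setIntegral_mono_on ((integrableOn_exp_neg_Ioi R).const_mul _)
          (hint.mono_set (Ioi_subset_Ioi hR.le)) measurableSet_Ioi fun t ht => ?_
        rw [mul_comm]
        have : R ≤ t := le_of_lt ht
        gcongr
    _ ≤ ∫ t in Ioi 0, Real.exp (-t) * t ^ x := by
        refine setIntegral_mono_set hint ?_ (Ioi_subset_Ioi hR.le).eventuallyLE
        filter_upwards [ae_restrict_mem measurableSet_Ioi] with t ht
        have : (0 : ℝ) < t := ht
        simp only [Pi.zero_apply]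
        positivity

/-- The Mittag-Leffler series converges absolutely everywhere. -/
lemma summable_inv_Gamma_mul_pow {α : ℝ} (hα : 0 < α) {r : ℝ} (hr : 0 ≤ r) :
    Summable fun n : ℕ => (Real.Gamma (n * α + 1))⁻¹ * r ^ n := by
  set R : ℝ := (2 * (r + 1)) ^ α⁻¹ with hRdef
  have hR : 0 < R := by positivity
  have hRα (n : ℕ) : R ^ (n * α) = (2 * (r + 1)) ^ n := by
    rw [hRdef, ← Real.rpow_mul (by positivity), ← Real.rpow_natCast]
    congr 1
    field_simp
  refine Summable.of_nonneg_of_le (fun n => ?_) (fun n => ?_)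
    ((summable_geometric_two).mul_left (Real.exp R))
  · have := Real.Gamma_pos_of_pos (show 0 < n * α + 1 by positivity)
    positivity
  · have h := rpow_mul_exp_neg_le_Gamma_add_one hR (show 0 ≤ n * α by positivity)
    rw [hRα] at h
    calc (Real.Gamma (n * α + 1))⁻¹ * r ^ n
        ≤ ((2 * (r + 1)) ^ n * Real.exp (-R))⁻¹ * (r + 1) ^ n := by gcongr; linarith
      _ = Real.exp R * (1 / 2) ^ n := by
        rw [Real.exp_neg, mul_pow, one_div, inv_pow]
        field_simp

/-- The Mittag-Leffler function is differentiable on the real line. -/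
lemma differentiable_tsum_inv_Gamma_mul_pow {α : ℝ} (hα : 0 < α) :
    Differentiable ℝ fun x : ℝ => ∑' n : ℕ, (Real.Gamma (n * α + 1))⁻¹ * x ^ n := by
  set p := FormalMultilinearSeries.ofScalars ℝ fun n : ℕ => (Real.Gamma (n * α + 1))⁻¹
  have hp : p.radius = ⊤ := by
    refine p.radius_eq_top_of_summable_norm fun r => ?_
    refine (summable_inv_Gamma_mul_pow hα r.coe_nonneg).congr fun n => ?_
    have := Real.Gamma_pos_of_pos (show 0 < n * α + 1 by positivity)
    rw [FormalMultilinearSeries.ofScalars_norm, Real.norm_of_nonneg (by positivity)]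
  have h := (p.hasFPowerSeriesOnBall (by simp [hp])).differentiableOn
  rw [hp, Metric.eball_top, differentiableOn_univ] at h
  have hsum : p.sum = fun x : ℝ => ∑' n : ℕ, (Real.Gamma (n * α + 1))⁻¹ * x ^ n :=
    funext fun x => FormalMultilinearSeries.ofScalars_sum_eq _ x
  rwa [hsum] at h

lemma rpow_natCast_mul_div_Gamma {t : ℝ} (ht : 0 ≤ t) (α : ℝ) (n : ℕ) :
    t ^ (n * α) / Real.Gamma (n * α + 1) = (Real.Gamma (n * α + 1))⁻¹ * (t ^ α) ^ n := by
  rw [mul_comm (n : ℝ) α, Real.rpow_mul_natCast ht, div_eq_inv_mul]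

lemma summable_rpow_div_Gamma {α : ℝ} (hα : 0 < α) {t : ℝ} (ht : 0 ≤ t) :
    Summable fun n : ℕ => t ^ (n * α) / Real.Gamma (n * α + 1) :=
  (summable_inv_Gamma_mul_pow hα (Real.rpow_nonneg ht α)).congr
    fun n => (rpow_natCast_mul_div_Gamma ht α n).symm

lemma differentiableAt_tsum_rpow_div_Gamma {α : ℝ} (hα : 0 < α) {t : ℝ} (ht : 0 < t) :
    DifferentiableAt ℝ (fun s : ℝ => ∑' n : ℕ, s ^ (n * α) / Real.Gamma (n * α + 1)) t := by
  have h : DifferentiableAt ℝ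
      (fun s : ℝ => ∑' n : ℕ, (Real.Gamma (n * α + 1))⁻¹ * (s ^ α) ^ n) t :=
    DifferentiableAt.comp (f := fun s : ℝ => s ^ α) t
      (differentiable_tsum_inv_Gamma_mul_pow hα _)
      (Real.differentiableAt_rpow_const_of_ne α ht.ne')
  refine h.congr_of_eventuallyEq ?_
  filter_upwards [eventually_gt_nhds ht] with s hs
  exact tsum_congr fun n => rpow_natCast_mul_div_Gamma hs.le α n

lemma intervalIntegrable_rpow_mul_sub_rpow {α β : ℝ} (hα : 0 < α) (hβ : 0 ≤ β) (s : ℝ) :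
    IntervalIntegrable (fun τ : ℝ => τ ^ β * (s - τ) ^ (α - 1)) volume 0 s := by
  have h : IntervalIntegrable (fun τ : ℝ => (s - τ) ^ (α - 1)) volume 0 s := by
    simpa using (intervalIntegral.intervalIntegrable_rpow' (a := s) (b := 0)
      (show -1 < α - 1 by linarith)).comp_sub_left s
  exact h.continuousOn_mul (Real.continuous_rpow_const hβ).continuousOn

/-- The Riemann–Liouville integral of order `α` of a power function. -/
lemma integral_rpow_mul_sub_rpow {α β s : ℝ} (hα : 0 < α) (hβ : 0 ≤ β) (hs : 0 < s) :
    ∫ τ in (0 : ℝ)..s, τ ^ β * (s - τ) ^ (α - 1) =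
      s ^ (β + α) * (Real.Gamma (β + 1) * Real.Gamma α / Real.Gamma (β + α + 1)) := by
  have hB := Complex.betaIntegral_scaled ((β + 1 : ℝ) : ℂ) (α : ℂ) hs
  have hG := Complex.Gamma_mul_Gamma_eq_betaIntegral (s := ((β + 1 : ℝ) : ℂ)) (t := (α : ℂ))
    (by rw [Complex.ofReal_re]; linarith) (by simpa using hα)
  have hpos : 0 < Real.Gamma (β + α + 1) := Real.Gamma_pos_of_pos (by linarith)
  have hne : (Real.Gamma (β + α + 1) : ℂ) ≠ 0 := Complex.ofReal_ne_zero.2 hpos.ne'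
  rw [← Complex.ofReal_add, Complex.Gamma_ofReal, Complex.Gamma_ofReal, Complex.Gamma_ofReal,
    show β + 1 + α = β + α + 1 by ring, mul_comm (Real.Gamma (β + α + 1) : ℂ),
    ← div_eq_iff hne] at hG
  have hI : ∫ τ in (0 : ℝ)..s, (τ : ℂ) ^ (((β + 1 : ℝ) : ℂ) - 1) * ((s : ℂ) - τ) ^ ((α : ℂ) - 1) =
      ((∫ τ in (0 : ℝ)..s, τ ^ β * (s - τ) ^ (α - 1) : ℝ) : ℂ) := by
    rw [← intervalIntegral.integral_ofReal]
    refine intervalIntegral.integral_congr fun τ hτ => ?_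
    rw [uIcc_of_le hs.le] at hτ
    simp only [Complex.ofReal_mul]
    rw [Complex.ofReal_cpow hτ.1, Complex.ofReal_cpow (sub_nonneg.2 hτ.2)]
    push_cast
    rw [add_sub_cancel_right]
  have hexp : ((β + 1 : ℝ) : ℂ) + α - 1 = ((β + α : ℝ) : ℂ) := by push_cast; ring
  rw [hI, ← hG, hexp, ← Complex.ofReal_cpow hs.le] at hB
  exact_mod_cast hB

/-- The Riemann–Liouville integral of order `α` of `E_α(t^α)` is `E_α(t^α) - 1`. -/
lemma integral_tsum_rpow_div_Gamma_mul_sub_rpow {α s : ℝ} (hα : 0 < α) (hs : 0 < s) :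
    ∫ τ in (0 : ℝ)..s, (∑' n : ℕ, τ ^ (n * α) / Real.Gamma (n * α + 1)) * (s - τ) ^ (α - 1) =
      Real.Gamma α * ((∑' n : ℕ, s ^ (n * α) / Real.Gamma (n * α + 1)) - 1) := by
  let F : ℕ → ℝ → ℝ := fun n τ => τ ^ (n * α) / Real.Gamma (n * α + 1) * (s - τ) ^ (α - 1)
  have hΓ (n : ℕ) : 0 < Real.Gamma (n * α + 1) := Real.Gamma_pos_of_pos (by positivity)
  have hF (n : ℕ) : F n = fun τ =>
      (Real.Gamma (n * α + 1))⁻¹ * (τ ^ (n * α) * (s - τ) ^ (α - 1)) := by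
    funext τ
    simp only [F]
    ring
  have hFint (n : ℕ) : Integrable (F n) (volume.restrict (Ioc 0 s)) := by
    rw [hF]
    exact ((intervalIntegrable_iff_integrableOn_Ioc_of_le hs.le).1
      (intervalIntegrable_rpow_mul_sub_rpow hα (by positivity) s)).const_mul _
  have hFval (n : ℕ) : ∫ τ in Ioc 0 s, F n τ =
      Real.Gamma α * (s ^ ((n + 1 : ℕ) * α) / Real.Gamma ((n + 1 : ℕ) * α + 1)) := by
    have hcast : ((n + 1 : ℕ) : ℝ) * α = n * α + α := by push_cast; ring
    rw [hF, integral_const_mul, ← intervalIntegral.integral_of_le hs.le,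
      integral_rpow_mul_sub_rpow hα (by positivity) hs, hcast]
    have := (hΓ n).ne'
    field_simp
  have hnorm (n : ℕ) : ∫ τ in Ioc 0 s, ‖F n τ‖ = ∫ τ in Ioc 0 s, F n τ := by
    refine setIntegral_congr_fun measurableSet_Ioc fun τ hτ => Real.norm_of_nonneg ?_
    have h₁ := hΓ n
    have h₂ := hτ.1
    have h₃ := sub_nonneg.2 hτ.2
    positivity
  have hsum := summable_rpow_div_Gamma hα hs.le
  have hsum' := ((summable_nat_add_iff 1).2 hsum).mul_left (Real.Gamma α)
  have h := hasSum_integral_of_summable_integral_norm hFint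
    (hsum'.congr fun n => by rw [hnorm, hFval])
  simp only [hFval] at h
  rw [hsum.tsum_eq_zero_add]
  simp only [Nat.cast_zero, zero_mul, Real.rpow_zero, zero_add, Real.Gamma_one, div_one,
    add_sub_cancel_left]
  rw [← tsum_mul_left, h.tsum_eq, intervalIntegral.integral_of_le hs.le]
  simp only [F, tsum_mul_right]

/-- For `0 < α < 1`, the function `y(t) = b₀ E_α(t^α)`,
i.e. `y(t) = b₀ Σ_{n=0}^∞ t^(nα)/Γ(nα+1)`, satisfies `y(0) = b₀` and, for every
`t > 0`, the function `u(t) = (1/Γ(α)) ∫_0^t y(τ)(t-τ)^(α-1) dτ` is differentiable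
at `t`, `y` is differentiable at `t`, and `u'(t) = y'(t)`; that is, `y` solves the
Riemann–Liouville equation `₀D_t^(1-α) y = y'` with `y(0) = b₀`. -/
theorem mittagLeffler_solves_riemannLiouville_fde (α b₀ : ℝ) (hα₁ : 0 < α) (hα₂ : α < 1)
    (y : ℝ → ℝ)
    (hy : ∀ t : ℝ, y t = b₀ * ∑' n : ℕ, t ^ ((n : ℝ) * α) / Real.Gamma ((n : ℝ) * α + 1)) :
    y 0 = b₀ ∧
    ∀ t > (0:ℝ),
      DifferentiableAt ℝ
        (fun s : ℝ => (1 / Real.Gamma α) * ∫ τ in (0:ℝ)..s, y τ * (s - τ) ^ (α - 1)) t ∧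
      DifferentiableAt ℝ y t ∧
      deriv (fun s : ℝ => (1 / Real.Gamma α) * ∫ τ in (0:ℝ)..s, y τ * (s - τ) ^ (α - 1)) t
        = deriv y t := by
  have hΓ := (Real.Gamma_pos_of_pos hα₁).ne'
  refine ⟨?_, fun t ht => ?_⟩
  · rw [hy, tsum_eq_single 0 fun n hn => ?_]
    · simp
    · rw [Real.zero_rpow (by positivity), zero_div]
  have hyd : DifferentiableAt ℝ y t := by
    rw [funext hy]
    exact (differentiableAt_tsum_rpow_div_Gamma hα₁ ht).const_mul b₀
  have hu : (fun s : ℝ => (1 / Real.Gamma α) * ∫ τ in (0:ℝ)..s, y τ * (s - τ) ^ (α - 1))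
      =ᶠ[𝓝 t] fun s => y s - b₀ := by
    filter_upwards [eventually_gt_nhds ht] with s hs
    simp only [hy, mul_assoc]
    rw [intervalIntegral.integral_const_mul, integral_tsum_rpow_div_Gamma_mul_sub_rpow hα₁ hs]
    rw [one_div, mul_left_comm b₀, inv_mul_cancel_left₀ hΓ, mul_sub_one]
  exact ⟨(hyd.sub_const b₀).congr_of_eventuallyEq hu, hyd, by rw [hu.deriv_eq, deriv_sub_const]⟩
end

section
/- Let 1 < α < 2, w ∈ ℝ, and c₀, c₁ ∈ ℝ. Define y(t) = c₀ Σ_{n=0}^∞ (-w²)^n t^{nα}/Γ(nα+1) + c₁ Σ_{n=0}^∞ (-w²)^n t^{nα+1}/Γ(nα+2) for t ≥ 0 (that is, y(t) = c₀ E_{α,1}(-w² t^α) + c₁ t E_{α,2}(-w² t^α)). Then y(0) = c₀, y is differentiable at 0 from the right with y'(0) = c₁, y is twice differentiable on (0,∞), and for every t > 0 one has (1/Γ(2-α)) ∫_0^t y''(s) (t-s)^{1-α} ds + w² y(t) = 0. (That is, y solves the fractional oscillation equation ᶜD^α y + w² y = 0 with y(0) = c₀ and y'(0) = c₁.) -/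
open MeasureTheory Set Filter Topology

/-- The series `∑ qⁿ t^(nα+β) / Γ(nα+β+1)`, that is, `t^β E_{α,β+1}(q t^α)` for `t > 0`. -/
noncomputable def mittagLefflerSeries (α q β t : ℝ) : ℝ :=
  ∑' n : ℕ, q ^ n * t ^ ((n : ℝ) * α + β) / Real.Gamma ((n : ℝ) * α + β + 1)

lemma div_Gamma_add_one (s : ℝ) : s / Real.Gamma (s + 1) = 1 / Real.Gamma s := by
  rcases eq_or_ne s 0 with rfl | hs
  · simp [Real.Gamma_zero]
  · rw [Real.Gamma_add_one hs, div_mul_eq_div_div, div_self hs]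

lemma summable_pow_div_Gamma {α β : ℝ} (hα : 1 ≤ α) (hβ : -2 ≤ β) (x : ℝ) :
    Summable fun n : ℕ => x ^ n / Real.Gamma ((n : ℝ) * α + β + 1) := by
  rw [← summable_nat_add_iff 3]
  refine Summable.of_norm_bounded
    ((Real.summable_pow_div_factorial |x|).mul_left (|x| ^ 3)) fun n => ?_
  have hle : (n : ℝ) + 2 ≤ ((n + 3 : ℕ) : ℝ) * α + β + 1 := by
    push_cast
    nlinarith [(Nat.cast_nonneg n : (0 : ℝ) ≤ n)]
  have hn : (2 : ℝ) ≤ (n : ℝ) + 2 := by simp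
  have hmono := Real.Gamma_strictMonoOn_Ici.monotoneOn hn (hn.trans hle) hle
  have hfact : (n.factorial : ℝ) ≤ Real.Gamma ((n : ℝ) + 2) := by
    have h := Real.Gamma_nat_eq_factorial (n + 1)
    push_cast at h
    rw [show (n : ℝ) + 2 = n + 1 + 1 by ring, h]
    exact_mod_cast Nat.factorial_le (Nat.le_succ n)
  have hpos : (0 : ℝ) < n.factorial := by positivity
  rw [norm_div, norm_pow, Real.norm_eq_abs, Real.norm_of_nonneg (by linarith), pow_add,
    mul_comm (|x| ^ n), mul_div_assoc]
  gcongr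
  exact hfact.trans hmono

lemma summable_mittagLefflerSeries {α β t : ℝ} (hα : 1 ≤ α) (hβ : -2 ≤ β) (q : ℝ) (ht : 0 < t) :
    Summable fun n : ℕ => q ^ n * t ^ ((n : ℝ) * α + β) / Real.Gamma ((n : ℝ) * α + β + 1) := by
  refine ((summable_pow_div_Gamma hα hβ (q * t ^ α)).mul_left (t ^ β)).congr fun n => ?_
  rw [Real.rpow_add ht, mul_comm (n : ℝ) α, Real.rpow_mul_natCast ht.le, mul_pow]
  ring

/-- Termwise differentiation lowers the exponent parameter by one. -/
lemma hasDerivAt_mittagLefflerSeries {α β t : ℝ} (hα : 1 ≤ α) (hβ : -1 ≤ β) (q : ℝ) (ht : 0 < t) :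
    HasDerivAt (mittagLefflerSeries α q β) (mittagLefflerSeries α q (β - 1) t) t := by
  have hlo : 0 < t / 2 := by positivity
  have hhi : 0 < 2 * t := by positivity
  have hmem : t ∈ Ioo (t / 2) (2 * t) := ⟨by linarith, by linarith⟩
  refine hasDerivAt_tsum_of_isPreconnected
    (g := fun (n : ℕ) s => q ^ n * s ^ ((n : ℝ) * α + β) / Real.Gamma ((n : ℝ) * α + β + 1))
    (g' := fun (n : ℕ) s =>
      q ^ n * s ^ ((n : ℝ) * α + (β - 1)) / Real.Gamma ((n : ℝ) * α + (β - 1) + 1))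
    ((summable_mittagLefflerSeries hα (by linarith : -2 ≤ β - 1) q hlo).norm.add
      (summable_mittagLefflerSeries hα (by linarith : -2 ≤ β - 1) q hhi).norm)
    isOpen_Ioo isPreconnected_Ioo (fun n s hs => ?_) (fun n s hs => ?_) hmem
    (summable_mittagLefflerSeries hα (by linarith) q ht) hmem
  · have hs0 : 0 < s := hlo.trans hs.1
    have h := ((Real.hasDerivAt_rpow_const (p := (n : ℝ) * α + β)
      (Or.inl hs0.ne')).const_mul (q ^ n)).div_const (Real.Gamma ((n : ℝ) * α + β + 1))
    refine h.congr_deriv ?_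
    calc q ^ n * (((n : ℝ) * α + β) * s ^ ((n : ℝ) * α + β - 1)) / Real.Gamma (n * α + β + 1)
        = q ^ n * s ^ ((n : ℝ) * α + β - 1) *
            (((n : ℝ) * α + β) / Real.Gamma (n * α + β + 1)) := by ring
      _ = _ := by
        rw [div_Gamma_add_one, show (n : ℝ) * α + (β - 1) + 1 = n * α + β by ring,
          add_sub_assoc]
        ring
  · have hs0 : 0 < s := hlo.trans hs.1
    simp only [norm_div, norm_mul, Real.norm_of_nonneg (Real.rpow_nonneg hs0.le _),
      Real.norm_of_nonneg (Real.rpow_nonneg hlo.le _),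
      Real.norm_of_nonneg (Real.rpow_nonneg hhi.le _)]
    rw [← add_div, ← mul_add]
    gcongr
    rcases le_total 0 ((n : ℝ) * α + (β - 1)) with he | he
    · exact (Real.rpow_le_rpow hs0.le hs.2.le he).trans
        (le_add_of_nonneg_left (Real.rpow_nonneg hlo.le _))
    · exact (Real.rpow_le_rpow_of_nonpos hlo hs.1.le he).trans
        (le_add_of_nonneg_right (Real.rpow_nonneg hhi.le _))

/-- When `1/Γ(β+1)` vanishes the series starts at `n = 1`. -/
lemma mittagLefflerSeries_eq_mul {α β t : ℝ} (hα : 1 ≤ α) (hβ : -2 ≤ β) (q : ℝ) (ht : 0 < t)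
    (hΓ : Real.Gamma (β + 1) = 0) :
    mittagLefflerSeries α q β t = q * mittagLefflerSeries α q (α + β) t := by
  rw [mittagLefflerSeries, (summable_mittagLefflerSeries hα hβ q ht).tsum_eq_zero_add,
    mittagLefflerSeries, ← tsum_mul_left]
  simp only [Nat.cast_zero, zero_mul, zero_add, hΓ, div_zero]
  refine tsum_congr fun n => ?_
  rw [show ((n + 1 : ℕ) : ℝ) * α + β = n * α + (α + β) by push_cast; ring]
  ring

lemma mittagLefflerSeries_zero_zero {α : ℝ} (hα : 0 < α) (q : ℝ) :
    mittagLefflerSeries α q 0 0 = 1 := by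
  rw [mittagLefflerSeries, tsum_eq_single 0]
  · simp
  · intro n hn
    have : (n : ℝ) * α + 0 ≠ 0 := by positivity
    rw [Real.zero_rpow this]
    simp

lemma mittagLefflerSeries_zero_of_pos {α β : ℝ} (hα : 0 ≤ α) (hβ : 0 < β) (q : ℝ) :
    mittagLefflerSeries α q β 0 = 0 := by
  refine (tsum_congr fun n => ?_).trans (tsum_zero (β := ℕ))
  have : (n : ℝ) * α + β ≠ 0 := by positivity
  rw [Real.zero_rpow this]
  simp

lemma continuousOn_mittagLefflerSeries {α β : ℝ} (hα : 1 ≤ α) (hβ : 0 ≤ β) (q : ℝ) :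
    ContinuousOn (mittagLefflerSeries α q β) (Ico 0 1) := by
  refine continuousOn_tsum (fun n => ?_)
    (summable_mittagLefflerSeries hα (by linarith : -2 ≤ β) q one_pos).norm (fun n s hs => ?_)
  · exact ((Real.continuous_rpow_const (by positivity)).continuousOn.const_mul _).div_const _
  · simp only [norm_div, norm_mul, Real.norm_of_nonneg (Real.rpow_nonneg hs.1 _), Real.one_rpow,
      norm_one]
    gcongr
    exact Real.rpow_le_one hs.1 hs.2.le (by positivity)

lemma tendsto_mittagLefflerSeries {α β : ℝ} (hα : 1 ≤ α) (hβ : 0 ≤ β) (q : ℝ) :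
    Tendsto (mittagLefflerSeries α q β) (𝓝[>] 0) (𝓝 (mittagLefflerSeries α q β 0)) := by
  have h := continuousOn_mittagLefflerSeries hα hβ q 0 (by simp)
  rw [ContinuousWithinAt, nhdsWithin_Ico_eq_nhdsGE one_pos] at h
  exact h.mono_left (nhdsWithin_mono _ Ioi_subset_Ici_self)

/-- The Beta integral over `[0, t]` with real exponents. -/
lemma integral_rpow_mul_sub_rpow_s4 {u v t : ℝ} (hu : 0 < u) (hv : 0 < v) (ht : 0 < t) :
    ∫ s in (0 : ℝ)..t, s ^ (u - 1) * (t - s) ^ (v - 1) =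
      t ^ (u + v - 1) * (Real.Gamma u * Real.Gamma v / Real.Gamma (u + v)) := by
  have h := Complex.betaIntegral_scaled u v ht
  rw [Complex.betaIntegral_eq_Gamma_mul_div _ _ (by simpa) (by simpa), ← Complex.ofReal_add,
    Complex.Gamma_ofReal, Complex.Gamma_ofReal, Complex.Gamma_ofReal, ← Complex.ofReal_one,
    ← Complex.ofReal_sub, ← Complex.ofReal_sub, ← Complex.ofReal_sub,
    ← Complex.ofReal_cpow ht.le] at h
  have hcongr : ∫ s in (0 : ℝ)..t, (s : ℂ) ^ ((u - 1 : ℝ) : ℂ) * ((t : ℂ) - s) ^ ((v - 1 : ℝ) : ℂ)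
      = ∫ s in (0 : ℝ)..t, ((s ^ (u - 1) * (t - s) ^ (v - 1) : ℝ) : ℂ) := by
    refine intervalIntegral.integral_congr fun s hs => ?_
    rw [uIcc_of_le ht.le] at hs
    rw [← Complex.ofReal_sub, ← Complex.ofReal_cpow hs.1,
      ← Complex.ofReal_cpow (sub_nonneg.2 hs.2), ← Complex.ofReal_mul]
  rw [hcongr, intervalIntegral.integral_ofReal] at h
  exact_mod_cast h

lemma integrableOn_rpow_mul_sub_rpow {u v t : ℝ} (hu : 0 < u) (hv : 0 < v) (ht : 0 < t) :
    IntegrableOn (fun s => s ^ (u - 1) * (t - s) ^ (v - 1)) (Ioc 0 t) := by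
  rw [← intervalIntegrable_iff_integrableOn_Ioc_of_le ht.le]
  by_contra hnot
  have h := integral_rpow_mul_sub_rpow_s4 hu hv ht
  rw [intervalIntegral.integral_undef hnot] at h
  have := Real.Gamma_pos_of_pos hu
  have := Real.Gamma_pos_of_pos hv
  have := Real.Gamma_pos_of_pos (add_pos hu hv)
  have : 0 < t ^ (u + v - 1) * (Real.Gamma u * Real.Gamma v / Real.Gamma (u + v)) := by positivity
  exact this.ne h

/-- Fractional integration of order `v` raises the exponent parameter by `v`. -/
lemma integral_mittagLefflerSeries_mul_sub_rpow {α β v t : ℝ} (hα : 1 ≤ α) (hβ : -1 < β)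
    (hv : 0 < v) (q : ℝ) (ht : 0 < t) :
    ∫ s in Ioc 0 t, mittagLefflerSeries α q β s * (t - s) ^ (v - 1) =
      Real.Gamma v * mittagLefflerSeries α q (β + v) t := by
  have hpos (n : ℕ) : 0 < (n : ℝ) * α + β + 1 := by
    have : 0 ≤ (n : ℝ) * α := by positivity
    linarith
  have hint (n : ℕ) : IntegrableOn
      (fun s => s ^ ((n : ℝ) * α + β) * (t - s) ^ (v - 1)) (Ioc 0 t) := by
    simpa using integrableOn_rpow_mul_sub_rpow (hpos n) hv ht
  have hval (n : ℕ) (p : ℝ) :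
      ∫ s in Ioc 0 t, p ^ n / Real.Gamma ((n : ℝ) * α + β + 1) *
          (s ^ ((n : ℝ) * α + β) * (t - s) ^ (v - 1)) =
        Real.Gamma v * (p ^ n * t ^ ((n : ℝ) * α + (β + v)) /
          Real.Gamma ((n : ℝ) * α + (β + v) + 1)) := by
    have h := integral_rpow_mul_sub_rpow_s4 (hpos n) hv ht
    rw [add_sub_cancel_right, intervalIntegral.integral_of_le ht.le] at h
    rw [integral_const_mul, h, show (n : ℝ) * α + β + 1 + v - 1 = n * α + (β + v) by ring,
      show (n : ℝ) * α + β + 1 + v = n * α + (β + v) + 1 by ring]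
    have := (Real.Gamma_pos_of_pos (hpos n)).ne'
    field_simp
  have hsum := hasSum_integral_of_summable_integral_norm
    (μ := volume.restrict (Ioc 0 t))
    (F := fun (n : ℕ) s => q ^ n / Real.Gamma ((n : ℝ) * α + β + 1) *
      (s ^ ((n : ℝ) * α + β) * (t - s) ^ (v - 1)))
    (fun n => (hint n).const_mul _) (by
      refine ((summable_mittagLefflerSeries hα (by linarith : -2 ≤ β + v) |q| ht).mul_left
        (Real.Gamma v)).congr fun n => ?_
      rw [← hval n |q|]
      refine setIntegral_congr_fun measurableSet_Ioc fun s hs => ?_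
      simp only [norm_mul, norm_div, norm_pow, Real.norm_eq_abs,
        abs_of_pos (Real.Gamma_pos_of_pos (hpos n)), abs_of_nonneg (Real.rpow_nonneg hs.1.le _),
        abs_of_nonneg (Real.rpow_nonneg (sub_nonneg.2 hs.2) _)])
  rw [mittagLefflerSeries, ← tsum_mul_left]
  simp only [hval] at hsum
  rw [hsum.tsum_eq]
  refine setIntegral_congr_fun measurableSet_Ioc fun s _ => ?_
  simp only [mittagLefflerSeries]
  rw [← tsum_mul_right]
  exact tsum_congr fun n => by ring

lemma mittagLefflerSeries_pos {α β q t : ℝ} (hα : 1 ≤ α) (hβ : -1 < β) (hq : 0 ≤ q) (ht : 0 < t) :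
    0 < mittagLefflerSeries α q β t := by
  have hΓ (n : ℕ) : 0 < Real.Gamma ((n : ℝ) * α + β + 1) := by
    have : 0 ≤ (n : ℝ) * α := by positivity
    exact Real.Gamma_pos_of_pos (by linarith)
  refine (summable_mittagLefflerSeries hα (by linarith) q ht).tsum_pos (fun n => ?_) 0 ?_
  · have := hΓ n
    positivity
  · have := hΓ 0
    rw [pow_zero]
    positivity

lemma integrableOn_mittagLefflerSeries_mul_sub_rpow {α β v t : ℝ} (hα : 1 ≤ α) (hβ : -1 < β)
    (hv : 0 < v) (q : ℝ) (ht : 0 < t) :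
    IntegrableOn (fun s => mittagLefflerSeries α q β s * (t - s) ^ (v - 1)) (Ioc 0 t) := by
  have habs : IntegrableOn (fun s => mittagLefflerSeries α |q| β s * (t - s) ^ (v - 1))
      (Ioc 0 t) := by
    by_contra hnot
    have h := integral_mittagLefflerSeries_mul_sub_rpow hα hβ hv |q| ht
    rw [integral_undef hnot] at h
    exact (mul_pos (Real.Gamma_pos_of_pos hv)
      (mittagLefflerSeries_pos hα (by linarith) (abs_nonneg q) ht)).ne h
  have hcont : ContinuousOn (mittagLefflerSeries α q β) (Ioc 0 t) := fun s hs =>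
    (hasDerivAt_mittagLefflerSeries hα hβ.le q hs.1).continuousAt.continuousWithinAt
  refine habs.mono' ((hcont.aestronglyMeasurable measurableSet_Ioc).mul
    (Measurable.aestronglyMeasurable (by fun_prop))) ?_
  filter_upwards [ae_restrict_mem measurableSet_Ioc] with s hs
  rw [norm_mul, Real.norm_of_nonneg (Real.rpow_nonneg (sub_nonneg.2 hs.2) _)]
  refine mul_le_mul_of_nonneg_right ?_ (Real.rpow_nonneg (sub_nonneg.2 hs.2) _)
  refine (norm_tsum_le_tsum_norm
    (summable_mittagLefflerSeries hα (by linarith) q hs.1).norm).trans_eq ?_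
  refine tsum_congr fun n => ?_
  have : 0 ≤ (n : ℝ) * α := by positivity
  rw [norm_div, norm_mul, norm_pow, Real.norm_eq_abs q,
    Real.norm_of_nonneg (Real.rpow_nonneg hs.1.le _),
    Real.norm_of_nonneg (Real.Gamma_pos_of_pos (by linarith)).le]


/-- For `1 < α < 2`, the function
`y(t) = c₀ E_{α,1}(-w² t^α) + c₁ t E_{α,2}(-w² t^α)` satisfies `y(0) = c₀`,
has right derivative `c₁` at `0`, is twice differentiable on `(0,∞)`, and solves
the fractional oscillation equation `ᶜD^α y + w² y = 0`. -/
theorem mittagLeffler_solves_fractional_oscillation (α w c₀ c₁ : ℝ)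
    (hα₁ : 1 < α) (hα₂ : α < 2)
    (y : ℝ → ℝ)
    (hy : ∀ t : ℝ, y t =
      c₀ * ∑' n : ℕ, (-w ^ 2) ^ n * t ^ ((n : ℝ) * α) / Real.Gamma ((n : ℝ) * α + 1)
      + c₁ * ∑' n : ℕ, (-w ^ 2) ^ n * t ^ ((n : ℝ) * α + 1) / Real.Gamma ((n : ℝ) * α + 2)) :
    y 0 = c₀ ∧
    HasDerivWithinAt y c₁ (Set.Ici 0) 0 ∧
    DifferentiableOn ℝ y (Set.Ioi 0) ∧
    DifferentiableOn ℝ (deriv y) (Set.Ioi 0) ∧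
    ∀ t > (0:ℝ),
      (1 / Real.Gamma (2 - α)) *
          (∫ s in (0:ℝ)..t, deriv (deriv y) s * (t - s) ^ (1 - α)) + w ^ 2 * y t = 0 := by
  have hα : 1 ≤ α := hα₁.le
  set q := -w ^ 2 with hq
  have hy' : y = fun t => c₀ * mittagLefflerSeries α q 0 t + c₁ * mittagLefflerSeries α q 1 t := by
    funext t
    rw [hy]
    simp only [mittagLefflerSeries, add_zero, add_assoc, one_add_one_eq_two]
  have hderiv : ∀ t > 0, HasDerivAt y
      (c₀ * mittagLefflerSeries α q (-1) t + c₁ * mittagLefflerSeries α q 0 t) t := by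
    intro t ht
    rw [hy']
    have h₀ := hasDerivAt_mittagLefflerSeries hα (by norm_num : (-1 : ℝ) ≤ 0) q ht
    have h₁ := hasDerivAt_mittagLefflerSeries hα (by norm_num : (-1 : ℝ) ≤ 1) q ht
    rw [zero_sub] at h₀
    rw [sub_self] at h₁
    exact (h₀.const_mul c₀).add (h₁.const_mul c₁)
  have hderiv₂ : ∀ t > 0, HasDerivAt (deriv y)
      (c₀ * mittagLefflerSeries α q (-2) t + c₁ * mittagLefflerSeries α q (-1) t) t := by
    intro t ht
    have h₀ := hasDerivAt_mittagLefflerSeries hα (le_refl (-1 : ℝ)) q ht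
    have h₁ := hasDerivAt_mittagLefflerSeries hα (by norm_num : (-1 : ℝ) ≤ 0) q ht
    rw [show (-1 : ℝ) - 1 = -2 by norm_num] at h₀
    rw [zero_sub] at h₁
    refine ((h₀.const_mul c₀).add (h₁.const_mul c₁)).congr_of_eventuallyEq ?_
    filter_upwards [Ioi_mem_nhds ht] with s hs
    exact (hderiv s hs).deriv
  have hshift₁ : ∀ t > 0, mittagLefflerSeries α q (-1) t =
      q * mittagLefflerSeries α q (α + -1) t := fun t ht =>
    mittagLefflerSeries_eq_mul hα (by norm_num) q ht (by simp [Real.Gamma_zero])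
  have hshift₂ : ∀ t > 0, mittagLefflerSeries α q (-2) t =
      q * mittagLefflerSeries α q (α + -2) t := fun t ht =>
    mittagLefflerSeries_eq_mul hα le_rfl q ht (by
      rw [show (-2 : ℝ) + 1 = -((1 : ℕ) : ℝ) by norm_num]
      exact Real.Gamma_neg_nat_eq_zero 1)
  have hone : mittagLefflerSeries α q 1 0 = 0 :=
    mittagLefflerSeries_zero_of_pos (by linarith) one_pos q
  have hzero : mittagLefflerSeries α q 0 0 = 1 :=
    mittagLefflerSeries_zero_zero (by linarith) q
  have hy0 : y 0 = c₀ := by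
    rw [hy']
    simp [hone, hzero]
  have hdiff : DifferentiableOn ℝ y (Ioi 0) := fun t ht =>
    (hderiv t ht).differentiableAt.differentiableWithinAt
  refine ⟨hy0, ?_, hdiff, fun t ht => (hderiv₂ t ht).differentiableAt.differentiableWithinAt, ?_⟩
  · refine hasDerivWithinAt_Ici_of_tendsto_deriv hdiff ?_ self_mem_nhdsWithin ?_
    · rw [ContinuousWithinAt, hy']
      exact ((tendsto_mittagLefflerSeries hα le_rfl q).const_mul c₀).add
        ((tendsto_mittagLefflerSeries hα zero_le_one q).const_mul c₁)
    · have h := (((tendsto_mittagLefflerSeries hα (by linarith : 0 ≤ α + -1) q).const_mul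
        q).const_mul c₀).add ((tendsto_mittagLefflerSeries hα le_rfl q).const_mul c₁)
      rw [mittagLefflerSeries_zero_of_pos (by linarith) (by linarith), hzero] at h
      simp only [mul_zero, zero_add, mul_one] at h
      refine h.congr' ?_
      filter_upwards [self_mem_nhdsWithin] with t ht
      rw [(hderiv t ht).deriv, hshift₁ t ht]
  · intro t ht
    have hv : 0 < 2 - α := by linarith
    have hI₀ := integrableOn_mittagLefflerSeries_mul_sub_rpow hα
      (by linarith : -1 < α + -2) hv q ht
    have hI₁ := integrableOn_mittagLefflerSeries_mul_sub_rpow hα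
      (by linarith : -1 < α + -1) hv q ht
    have hJ₀ := integral_mittagLefflerSeries_mul_sub_rpow hα
      (by linarith : -1 < α + -2) hv q ht
    have hJ₁ := integral_mittagLefflerSeries_mul_sub_rpow hα
      (by linarith : -1 < α + -1) hv q ht
    rw [show α + -2 + (2 - α) = 0 by ring] at hJ₀
    rw [show α + -1 + (2 - α) = 1 by ring] at hJ₁
    have hint : ∫ s in (0 : ℝ)..t, deriv (deriv y) s * (t - s) ^ (1 - α) =
        Real.Gamma (2 - α) * (q * y t) := by
      calc ∫ s in (0 : ℝ)..t, deriv (deriv y) s * (t - s) ^ (1 - α)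
          = ∫ s in Ioc 0 t,
              (c₀ * q * (mittagLefflerSeries α q (α + -2) s * (t - s) ^ (2 - α - 1)) +
                c₁ * q * (mittagLefflerSeries α q (α + -1) s * (t - s) ^ (2 - α - 1))) := by
            rw [intervalIntegral.integral_of_le ht.le]
            refine setIntegral_congr_fun measurableSet_Ioc fun s hs => ?_
            rw [(hderiv₂ s hs.1).deriv, hshift₁ s hs.1, hshift₂ s hs.1,
              show 2 - α - 1 = 1 - α by ring]
            ring
        _ = Real.Gamma (2 - α) * (q * y t) := by
            rw [integral_add (hI₀.const_mul _) (hI₁.const_mul _), integral_const_mul,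
              integral_const_mul, hJ₀, hJ₁, hy']
            ring
    have hΓ := (Real.Gamma_pos_of_pos hv).ne'
    rw [hint, hq]
    field_simp
    ring
end
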